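/- arXiv:1706.03469 — 4 statements merged into one kernel-verified Lean document; each statement's English description precedes it below -/
import Mathlib

section
/- Behavior Policy Gradient Theorem (Theorem 1): For every parameter θ, the mean squared error MSE(θ) := Σ_h p(h)·w(θ,h)·(IS(h,θ) − ρ_e)² of the importance-sampling estimator is differentiable in θ, and its Fréchet derivative satisfies fderiv ℝ MSE θ = Σ_{h ∈ Traj} (p(h) · w(θ,h) · (−(IS(h,θ))²)) • (Σ_{t=0}^{L} score_t(θ,h)), i.e., the gradient of the MSE equals the expectation over trajectories H ∼ Pr(·|θ) of −IS(H,θ)² times the sum of per-step score functions. -/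
/-- The reciprocal of a finite product of positive differentiable functions has derivative minus
the reciprocal times the sum of the logarithmic derivatives. -/
theorem hasFDerivAt_inv_prod_of_pos {ι E : Type*} [NormedAddCommGroup E] [NormedSpace ℝ E]
    {s : Finset ι} {f : ι → E → ℝ} {x : E} (hpos : ∀ i ∈ s, ∀ y, 0 < f i y)
    (hdiff : ∀ i ∈ s, DifferentiableAt ℝ (f i) x) :
    HasFDerivAt (fun y => (∏ i ∈ s, f i y)⁻¹)
      ((∏ i ∈ s, f i x)⁻¹ • -∑ i ∈ s, fderiv ℝ (fun y => Real.log (f i y)) x) x := by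
  have hexp (y : E) : (∏ i ∈ s, f i y)⁻¹ = Real.exp (-∑ i ∈ s, Real.log (f i y)) := by
    rw [Real.exp_neg, Real.exp_sum]
    exact congrArg _ (Finset.prod_congr rfl fun i hi => (Real.exp_log (hpos i hi y)).symm)
  simp only [hexp]
  exact (HasFDerivAt.fun_sum fun i hi =>
    ((hdiff i hi).log (hpos i hi x).ne').hasFDerivAt).fun_neg.exp

/-- **Behavior Policy Gradient Theorem (Theorem 1).**
For every parameter `θ`, the mean squared error of the importance-sampling estimator,
`MSE(θ) = Σ_h p(h)·w(θ,h)·(IS(h,θ) − ρ_e)²`, is differentiable in `θ`, and its derivative is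
`Σ_h (p(h)·w(θ,h)·(−IS(h,θ)²)) • (Σ_{t=0}^{L} score_t(θ,h))`. -/
theorem behavior_policy_gradient_theorem
    {S A Traj : Type*} [Fintype S] [Nonempty S] [Fintype A] [Nonempty A] [Fintype Traj]
    {Θ : Type*} [NormedAddCommGroup Θ] [NormedSpace ℝ Θ] [FiniteDimensional ℝ Θ]
    (L : ℕ)
    (st : Traj → ℕ → S) (ac : Traj → ℕ → A) (rew : Traj → ℕ → ℝ)
    (Rset : Finset ℝ) (hRset : Rset.Nonempty) (hrew : ∀ h t, rew h t ∈ Rset)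
    (π : Θ → S → A → ℝ)
    (hπpos : ∀ θ s a, 0 < π θ s a)
    (hπdiff : ∀ s a, Differentiable ℝ (fun θ => π θ s a))
    (p : Traj → ℝ) (hp : ∀ h, 0 ≤ p h)
    (w : Θ → Traj → ℝ)
    (hw : ∀ θ h, w θ h = ∏ t ∈ Finset.range (L + 1), π θ (st h t) (ac h t))
    (hnorm : ∀ θ, ∑ h : Traj, p h * w θ h = 1)
    (γ : ℝ) (g : Traj → ℝ)
    (hg : ∀ h, g h = ∑ t ∈ Finset.range (L + 1), γ ^ t * rew h t)
    (θe : Θ) (ρe : ℝ) (hρe : ρe = ∑ h : Traj, p h * w θe h * g h)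
    (IS : Traj → Θ → ℝ) (hIS : ∀ h θ, IS h θ = g h * w θe h / w θ h)
    (score : ℕ → Θ → Traj → (Θ →L[ℝ] ℝ))
    (hscore : ∀ t θ h,
      score t θ h = fderiv ℝ (fun θ' => Real.log (π θ' (st h t) (ac h t))) θ)
    (θ : Θ) :
    DifferentiableAt ℝ (fun θ' => ∑ h : Traj, p h * w θ' h * (IS h θ' - ρe) ^ 2) θ ∧
    fderiv ℝ (fun θ' => ∑ h : Traj, p h * w θ' h * (IS h θ' - ρe) ^ 2) θ =
      ∑ h : Traj,
        (p h * w θ h * (-(IS h θ) ^ 2)) • (∑ t ∈ Finset.range (L + 1), score t θ h) := by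
  have hwpos (θ' : Θ) (h : Traj) : 0 < w θ' h := by
    rw [hw]
    exact Finset.prod_pos fun t _ => hπpos _ _ _
  have hinv (h : Traj) : HasFDerivAt (fun θ' => (w θ' h)⁻¹)
      ((w θ h)⁻¹ • -∑ t ∈ Finset.range (L + 1), score t θ h) θ := by
    simp only [hw, hscore]
    exact hasFDerivAt_inv_prod_of_pos (fun t _ y => hπpos y _ _) (fun t _ => hπdiff _ _ θ)
  have hmse (θ' : Θ) : ∑ h : Traj, p h * w θ' h * (IS h θ' - ρe) ^ 2 =
      ∑ h : Traj, p h * (g h * w θe h) ^ 2 * (w θ' h)⁻¹ - ρe ^ 2 := by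
    have hterm (h : Traj) : p h * w θ' h * (IS h θ' - ρe) ^ 2 =
        p h * (g h * w θe h) ^ 2 * (w θ' h)⁻¹ - 2 * ρe * (p h * w θe h * g h) +
          ρe ^ 2 * (p h * w θ' h) := by
      have := (hwpos θ' h).ne'
      rw [hIS]
      field_simp
      ring
    simp only [hterm, Finset.sum_add_distrib, Finset.sum_sub_distrib, ← Finset.mul_sum,
      hnorm, ← hρe]
    ring
  have hderiv : HasFDerivAt (fun θ' => ∑ h : Traj, p h * w θ' h * (IS h θ' - ρe) ^ 2)
      (∑ h : Traj,
        (p h * w θ h * (-(IS h θ) ^ 2)) • (∑ t ∈ Finset.range (L + 1), score t θ h)) θ := by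
    simp only [hmse]
    refine ((HasFDerivAt.fun_sum fun h _ => (hinv h).const_mul _).sub_const _).congr_fderiv ?_
    refine Finset.sum_congr rfl fun h _ => ?_
    rw [smul_neg, smul_neg, smul_smul, ← neg_smul, hIS]
    congr 1
    have := (hwpos θ h).ne'
    field_simp
  exact ⟨hderiv.differentiableAt, hderiv.fderiv⟩
end

section
/- Lemma 1 (MSE gradient of an unbiased off-policy estimator): Let OPE : Θ → Traj → ℝ be such that θ ↦ OPE(θ,h) is differentiable for every trajectory h, and suppose OPE is unbiased for every θ, i.e., Σ_h p(h)·w(θ,h)·OPE(θ,h) = ρ_e for all θ. Then for every θ, fderiv ℝ (θ' ↦ Σ_h p(h)·w(θ',h)·(OPE(θ',h) − ρ_e)²) θ = Σ_{h ∈ Traj} (p(h)·w(θ,h)) • ( (OPE(θ,h))² • (Σ_{t=0}^{L} score_t(θ,h)) + fderiv ℝ (θ' ↦ (OPE(θ',h))²) θ ). -/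
/-- The log-derivative trick for a finite product of positive differentiable functions. -/
theorem hasFDerivAt_prod_of_pos {E ι : Type*} [NormedAddCommGroup E] [NormedSpace ℝ E]
    {s : Finset ι} {f : ι → E → ℝ} {x : E} (hpos : ∀ i ∈ s, ∀ y, 0 < f i y)
    (hf : ∀ i ∈ s, DifferentiableAt ℝ (f i) x) :
    HasFDerivAt (fun y => ∏ i ∈ s, f i y)
      ((∏ i ∈ s, f i x) • ∑ i ∈ s, fderiv ℝ (fun y => Real.log (f i y)) x) x := by
  have hexp : ∀ y, Real.exp (∑ i ∈ s, Real.log (f i y)) = ∏ i ∈ s, f i y := fun y => by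
    rw [Real.exp_sum]
    exact Finset.prod_congr rfl fun i hi => Real.exp_log (hpos i hi y)
  have hlog := HasFDerivAt.fun_sum fun i hi =>
    ((hf i hi).log (hpos i hi x).ne').hasFDerivAt
  simpa only [hexp] using hlog.exp

/-- A weighted sum of squared deviations from the weighted mean, for weights of total mass one. -/
theorem sum_mul_sub_sq_eq {ι : Type*} {s : Finset ι} {q X : ι → ℝ} {m : ℝ}
    (hq : ∑ i ∈ s, q i = 1) (hX : ∑ i ∈ s, q i * X i = m) :
    ∑ i ∈ s, q i * (X i - m) ^ 2 = ∑ i ∈ s, q i * X i ^ 2 - m ^ 2 := by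
  calc ∑ i ∈ s, q i * (X i - m) ^ 2
      = ∑ i ∈ s, (q i * X i ^ 2 - 2 * m * (q i * X i) + m ^ 2 * q i) :=
        Finset.sum_congr rfl fun i _ => by ring
    _ = ∑ i ∈ s, q i * X i ^ 2 - m ^ 2 := by
        rw [Finset.sum_add_distrib, Finset.sum_sub_distrib, ← Finset.mul_sum, ← Finset.mul_sum,
          hX, hq]
        ring

/-- **Lemma 1 (MSE gradient of an unbiased off-policy estimator).**
If `OPE` is differentiable in `θ` for each trajectory and unbiased for every `θ`, then the
gradient of the MSE is
`Σ_h (p(h)·w(θ,h)) • ( OPE(θ,h)² • Σ_t score_t(θ,h) + ∂/∂θ OPE(θ,h)² )`. -/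
theorem mse_gradient_unbiased_ope
    {S A Traj : Type*} [Fintype S] [Nonempty S] [Fintype A] [Nonempty A] [Fintype Traj]
    {Θ : Type*} [NormedAddCommGroup Θ] [NormedSpace ℝ Θ] [FiniteDimensional ℝ Θ]
    (L : ℕ)
    (st : Traj → ℕ → S) (ac : Traj → ℕ → A) (rew : Traj → ℕ → ℝ)
    (Rset : Finset ℝ) (hRset : Rset.Nonempty) (hrew : ∀ h t, rew h t ∈ Rset)
    (π : Θ → S → A → ℝ)
    (hπpos : ∀ θ s a, 0 < π θ s a)
    (hπdiff : ∀ s a, Differentiable ℝ (fun θ => π θ s a))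
    (p : Traj → ℝ) (hp : ∀ h, 0 ≤ p h)
    (w : Θ → Traj → ℝ)
    (hw : ∀ θ h, w θ h = ∏ t ∈ Finset.range (L + 1), π θ (st h t) (ac h t))
    (hnorm : ∀ θ, ∑ h : Traj, p h * w θ h = 1)
    (γ : ℝ) (g : Traj → ℝ)
    (hg : ∀ h, g h = ∑ t ∈ Finset.range (L + 1), γ ^ t * rew h t)
    (θe : Θ) (ρe : ℝ) (hρe : ρe = ∑ h : Traj, p h * w θe h * g h)
    (score : ℕ → Θ → Traj → (Θ →L[ℝ] ℝ))
    (hscore : ∀ t θ h,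
      score t θ h = fderiv ℝ (fun θ' => Real.log (π θ' (st h t) (ac h t))) θ)
    (OPE : Θ → Traj → ℝ)
    (hOPEdiff : ∀ h, Differentiable ℝ (fun θ => OPE θ h))
    (hOPEunbiased : ∀ θ, ∑ h : Traj, p h * w θ h * OPE θ h = ρe)
    (θ : Θ) :
    fderiv ℝ (fun θ' => ∑ h : Traj, p h * w θ' h * (OPE θ' h - ρe) ^ 2) θ =
      ∑ h : Traj,
        (p h * w θ h) •
          ((OPE θ h) ^ 2 • (∑ t ∈ Finset.range (L + 1), score t θ h) +
            fderiv ℝ (fun θ' => (OPE θ' h) ^ 2) θ) := by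
  simp only [fun θ' => sum_mul_sub_sq_eq (hnorm θ') (hOPEunbiased θ')]
  have hweight (h : Traj) : HasFDerivAt (fun θ' => w θ' h)
      (w θ h • ∑ t ∈ Finset.range (L + 1), score t θ h) θ := by
    simp only [hw, hscore]
    exact hasFDerivAt_prod_of_pos (fun t _ θ' => hπpos θ' (st h t) (ac h t))
      fun t _ => hπdiff (st h t) (ac h t) θ
  have hterm (h : Traj) := ((hweight h).const_mul (p h)).fun_mul
    ((hOPEdiff h).fun_pow 2 θ).hasFDerivAt
  refine ((HasFDerivAt.fun_sum fun h _ => hterm h).sub_const (ρe ^ 2)).fderiv.trans ?_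
  refine Finset.sum_congr rfl fun h _ => ?_
  module
end

section
/- Corollary 1 (MSE gradient of the Doubly Robust estimator): Suppose the doubly robust estimator DR is unbiased for every θ, i.e., Σ_h p(h)·w(θ,h)·DR(h,θ) = ρ_e for all θ. Then for every θ, fderiv ℝ (θ' ↦ Σ_h p(h)·w(θ',h)·(DR(h,θ') − ρ_e)²) θ = Σ_{h ∈ Traj} (p(h)·w(θ,h)) • ( (DR(h,θ))² • (Σ_{t=0}^{L} score_t(θ,h)) − (2·DR(h,θ)) • (Σ_{t=0}^{L} (γ^t · δ_t(h) · w_t(θ_e,h)/w_t(θ,h)) • (Σ_{i=0}^{t} score_i(θ,h))) ). -/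
/-- The derivative of a finite product of positive functions in logarithmic form. -/
theorem hasFDerivAt_finset_prod_log {E ι : Type*} [NormedAddCommGroup E] [NormedSpace ℝ E]
    (s : Finset ι) (f : ι → E → ℝ) (x : E) (hpos : ∀ i y, 0 < f i y)
    (hf : ∀ i, DifferentiableAt ℝ (f i) x) :
    HasFDerivAt (fun y => ∏ i ∈ s, f i y)
      ((∏ i ∈ s, f i x) • ∑ i ∈ s, fderiv ℝ (fun y => Real.log (f i y)) x) x := by
  have exp_sum_log (y : E) : Real.exp (∑ i ∈ s, Real.log (f i y)) = ∏ i ∈ s, f i y := by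
    rw [Real.exp_sum]
    exact Finset.prod_congr rfl fun i _ => Real.exp_log (hpos i y)
  have hsum : HasFDerivAt (fun y => ∑ i ∈ s, Real.log (f i y))
      (∑ i ∈ s, fderiv ℝ (fun y => Real.log (f i y)) x) x :=
    HasFDerivAt.fun_sum fun i _ => ((hf i).log (hpos i x).ne').hasFDerivAt
  simpa only [exp_sum_log] using hsum.exp

/-- The derivative of the reciprocal of a function given by its logarithmic derivative. -/
theorem HasFDerivAt.const_div_of_smul {E : Type*} [NormedAddCommGroup E] [NormedSpace ℝ E]
    {f : E → ℝ} {x : E} {ℓ : E →L[ℝ] ℝ} (hf : HasFDerivAt f (f x • ℓ) x) (hx : f x ≠ 0) (c : ℝ) :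
    HasFDerivAt (fun y => c / f y) (-(c / f x) • ℓ) x := by
  have h := ((hasDerivAt_inv hx).const_mul c).comp_hasFDerivAt x hf
  simp only [← div_eq_mul_inv, Function.comp_def] at h
  refine h.congr_fderiv ?_
  rw [smul_smul]
  congr 1
  field_simp

/-- **Corollary 1 (MSE gradient of the Doubly Robust estimator).**
If the doubly robust estimator `DR` is unbiased for every `θ`, then the gradient of its MSE is
`Σ_h (p(h)·w(θ,h)) • ( DR(h,θ)² • Σ_t score_t(θ,h)
  − (2·DR(h,θ)) • Σ_t (γ^t·δ_t(h)·w_t(θ_e,h)/w_t(θ,h)) • Σ_{i≤t} score_i(θ,h) )`. -/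
theorem mse_gradient_doubly_robust
    {S A Traj : Type*} [Fintype S] [Nonempty S] [Fintype A] [Nonempty A] [Fintype Traj]
    {Θ : Type*} [NormedAddCommGroup Θ] [NormedSpace ℝ Θ] [FiniteDimensional ℝ Θ]
    (L : ℕ)
    (st : Traj → ℕ → S) (ac : Traj → ℕ → A) (rew : Traj → ℕ → ℝ)
    (Rset : Finset ℝ) (hRset : Rset.Nonempty) (hrew : ∀ h t, rew h t ∈ Rset)
    (π : Θ → S → A → ℝ)
    (hπpos : ∀ θ s a, 0 < π θ s a)
    (hπdiff : ∀ s a, Differentiable ℝ (fun θ => π θ s a))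
    (p : Traj → ℝ) (hp : ∀ h, 0 ≤ p h)
    (w : Θ → Traj → ℝ)
    (hw : ∀ θ h, w θ h = ∏ t ∈ Finset.range (L + 1), π θ (st h t) (ac h t))
    (wt : ℕ → Θ → Traj → ℝ)
    (hwt : ∀ t θ h, wt t θ h = ∏ i ∈ Finset.range (t + 1), π θ (st h i) (ac h i))
    (hnorm : ∀ θ, ∑ h : Traj, p h * w θ h = 1)
    (γ : ℝ) (g : Traj → ℝ)
    (hg : ∀ h, g h = ∑ t ∈ Finset.range (L + 1), γ ^ t * rew h t)
    (θe : Θ) (ρe : ℝ) (hρe : ρe = ∑ h : Traj, p h * w θe h * g h)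
    (score : ℕ → Θ → Traj → (Θ →L[ℝ] ℝ))
    (hscore : ∀ t θ h,
      score t θ h = fderiv ℝ (fun θ' => Real.log (π θ' (st h t) (ac h t))) θ)
    (qhat : S × A → ℝ) (vhat : S → ℝ)
    (δ : ℕ → Traj → ℝ)
    (hδ : ∀ t h, δ t h = rew h t - qhat (st h t, ac h t) + vhat (st h (t + 1)))
    (DR : Traj → Θ → ℝ)
    (hDR : ∀ h θ, DR h θ =
      vhat (st h 0) + ∑ t ∈ Finset.range (L + 1), γ ^ t * (wt t θe h / wt t θ h) * δ t h)
    (hDRunbiased : ∀ θ, ∑ h : Traj, p h * w θ h * DR h θ = ρe)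
    (θ : Θ) :
    fderiv ℝ (fun θ' => ∑ h : Traj, p h * w θ' h * (DR h θ' - ρe) ^ 2) θ =
      ∑ h : Traj,
        (p h * w θ h) •
          ((DR h θ) ^ 2 • (∑ t ∈ Finset.range (L + 1), score t θ h) -
            (2 * DR h θ) •
              (∑ t ∈ Finset.range (L + 1),
                (γ ^ t * δ t h * wt t θe h / wt t θ h) •
                  (∑ i ∈ Finset.range (t + 1), score i θ h))) := by
  have hmse (θ' : Θ) : ∑ h : Traj, p h * w θ' h * (DR h θ' - ρe) ^ 2 =
      ∑ h : Traj, p h * w θ' h * DR h θ' ^ 2 - ρe ^ 2 := by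
    calc
      _ = ∑ h : Traj, p h * w θ' h * DR h θ' ^ 2
          - 2 * ρe * ∑ h : Traj, p h * w θ' h * DR h θ'
          + ρe ^ 2 * ∑ h : Traj, p h * w θ' h := by
        rw [Finset.mul_sum, Finset.mul_sum, ← Finset.sum_sub_distrib, ← Finset.sum_add_distrib]
        exact Finset.sum_congr rfl fun h _ => by ring
      _ = _ := by rw [hDRunbiased, hnorm]; ring
  have hprod (n : ℕ) (h : Traj) :
      HasFDerivAt (fun θ' => ∏ t ∈ Finset.range n, π θ' (st h t) (ac h t))
        ((∏ t ∈ Finset.range n, π θ (st h t) (ac h t)) • ∑ t ∈ Finset.range n, score t θ h) θ := by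
    simp only [hscore]
    exact hasFDerivAt_finset_prod_log _ (fun t θ' => π θ' (st h t) (ac h t)) θ
      (fun _ _ => hπpos _ _ _) fun _ => hπdiff _ _ θ
  have hw' (h : Traj) : HasFDerivAt (fun θ' => w θ' h)
      (w θ h • ∑ t ∈ Finset.range (L + 1), score t θ h) θ := by
    simpa only [hw] using hprod (L + 1) h
  have hratio (t : ℕ) (h : Traj) : HasFDerivAt (fun θ' => wt t θe h / wt t θ' h)
      (-(wt t θe h / wt t θ h) • ∑ i ∈ Finset.range (t + 1), score i θ h) θ := by
    have hwt' : HasFDerivAt (fun θ' => wt t θ' h)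
        (wt t θ h • ∑ i ∈ Finset.range (t + 1), score i θ h) θ := by
      simpa only [hwt] using hprod (t + 1) h
    refine hwt'.const_div_of_smul ?_ _
    rw [hwt]
    exact (Finset.prod_pos fun _ _ => hπpos _ _ _).ne'
  have hDR' (h : Traj) : HasFDerivAt (DR h)
      (-∑ t ∈ Finset.range (L + 1), (γ ^ t * δ t h * wt t θe h / wt t θ h) •
        ∑ i ∈ Finset.range (t + 1), score i θ h) θ := by
    rw [funext (hDR h), ← Finset.sum_neg_distrib]
    refine (HasFDerivAt.fun_sum fun t _ => ?_).const_add _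
    refine (((hratio t h).const_mul (γ ^ t)).mul_const (δ t h)).congr_fderiv ?_
    rw [smul_smul, smul_smul]
    refine Eq.trans ?_ (neg_smul _ _)
    congr 1
    ring
  simp only [hmse]
  refine ((HasFDerivAt.fun_sum fun h _ => ?_).sub_const _).fderiv
  refine (((hw' h).const_mul (p h)).mul ((hDR' h).pow 2)).congr_fderiv ?_
  module
end

section
/- Unbiasedness of BPG's adaptive off-policy estimate (Appendix B): Let f : Traj → Θ be any update rule mapping a trajectory to the next behavior-policy parameters, and define E_n : Θ → ℝ recursively by E_0(θ) := Σ_h Pr(h|θ)·IS(h,θ) and E_{k+1}(θ) := Σ_h Pr(h|θ)·E_k(f(h)). Then for every n : ℕ and every θ ∈ Θ, E_n(θ) = ρ_e. In particular, the importance-sampling estimate at iteration n of an adaptive procedure in which θ_{i+1} = f(H_i) and H_i ∼ Pr(·|θ_i) is an unbiased estimate of ρ_e. -/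
/-- **Unbiasedness of BPG's adaptive off-policy estimate (Appendix B).**
For any update rule `f : Traj → Θ`, defining `E_0(θ) = Σ_h Pr(h|θ)·IS(h,θ)` and
`E_{k+1}(θ) = Σ_h Pr(h|θ)·E_k(f(h))`, we have `E_n(θ) = ρ_e` for every `n` and `θ`. -/
theorem bpg_adaptive_estimate_unbiased
    {S A Traj : Type*} [Fintype S] [Nonempty S] [Fintype A] [Nonempty A] [Fintype Traj]
    {Θ : Type*} [NormedAddCommGroup Θ] [NormedSpace ℝ Θ] [FiniteDimensional ℝ Θ]
    (L : ℕ)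
    (st : Traj → ℕ → S) (ac : Traj → ℕ → A) (rew : Traj → ℕ → ℝ)
    (Rset : Finset ℝ) (hRset : Rset.Nonempty) (hrew : ∀ h t, rew h t ∈ Rset)
    (π : Θ → S → A → ℝ)
    (hπpos : ∀ θ s a, 0 < π θ s a)
    (p : Traj → ℝ) (hp : ∀ h, 0 ≤ p h)
    (w : Θ → Traj → ℝ)
    (hw : ∀ θ h, w θ h = ∏ t ∈ Finset.range (L + 1), π θ (st h t) (ac h t))
    (hnorm : ∀ θ, ∑ h : Traj, p h * w θ h = 1)
    (γ : ℝ) (g : Traj → ℝ)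
    (hg : ∀ h, g h = ∑ t ∈ Finset.range (L + 1), γ ^ t * rew h t)
    (θe : Θ) (ρe : ℝ) (hρe : ρe = ∑ h : Traj, p h * w θe h * g h)
    (IS : Traj → Θ → ℝ) (hIS : ∀ h θ, IS h θ = g h * w θe h / w θ h)
    (f : Traj → Θ)
    (E : ℕ → Θ → ℝ)
    (hE0 : ∀ θ, E 0 θ = ∑ h : Traj, p h * w θ h * IS h θ)
    (hEsucc : ∀ k θ, E (k + 1) θ = ∑ h : Traj, p h * w θ h * E k (f h)) :
    ∀ (n : ℕ) (θ : Θ), E n θ = ρe := by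
  have hw_ne : ∀ θ h, w θ h ≠ 0 := fun θ h => by
    rw [hw]
    exact (Finset.prod_pos fun t _ => hπpos θ (st h t) (ac h t)).ne'
  intro n
  induction n with
  | zero =>
    intro θ
    rw [hE0, hρe]
    refine Finset.sum_congr rfl fun h _ => ?_
    have hne := hw_ne θ h
    rw [hIS]
    field_simp
  | succ k ih =>
    intro θ
    simp only [hEsucc, ih]
    rw [← Finset.sum_mul, hnorm, one_mul]
end
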